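/- The unit Euclidean spheres form a Lévy family: let S^n be the unit sphere of ℝ^{n+1} with the Euclidean distance and its rotation-invariant Borel probability measure μ_n. Then for every ε > 0, the concentration functions tend to zero: sup{1 − μ_n(A_ε) : A ⊆ S^n Borel, μ_n(A) ≥ 1/2} → 0 as n → ∞, where A_ε = {x ∈ S^n : d(x,A) < ε}; i.e. α_{S^n}(ε) → 0 for every ε > 0 (equivalently, the observable diameter of S^n tends to 0 while its characteristic size stays near √2). -/

import Mathlib

open MeasureTheory Metric Filter

/-- The concentration function of an mm-space `(X, d, μ)`:
`α_X(ε) = 1 − inf{ μ(A_ε) : A Borel, μ(A) ≥ 1/2 }`, where `A_ε` is the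
open `ε`-thickening of `A`. -/
noncomputable def concFn {X : Type*} [PseudoMetricSpace X] [MeasurableSpace X]
    (μ : Measure X) (ε : ℝ) : ℝ :=
  1 - sInf {r : ℝ | ∃ A : Set X, MeasurableSet A ∧ 1 / 2 ≤ (μ A).toReal ∧
      r = (μ (Metric.thickening ε A)).toReal}

section Helpers
open ProbabilityTheory

lemma pi_gauss_ac (n : ℕ) : (Measure.pi (fun _ : Fin n => gaussianReal 0 1)) ≪ (volume : Measure (Fin n → ℝ)) := by
  induction n with
  | zero =>
    rw [volume_pi, Measure.pi_of_empty, Measure.pi_of_empty]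
  | succ n ih =>
    have h1 := measurePreserving_piFinSuccAbove (fun _ : Fin (n+1) => gaussianReal 0 1) 0
    have h2 := volume_preserving_piFinSuccAbove (fun _ : Fin (n+1) => ℝ) 0
    rw [← h1.symm.map_eq, ← h2.symm.map_eq]
    refine Measure.AbsolutelyContinuous.map ?_ (MeasurableEquiv.measurable _)
    exact Measure.AbsolutelyContinuous.prod (gaussianReal_absolutelyContinuous 0 one_ne_zero) ih

lemma stdGauss_ac (n : ℕ) : stdGaussian (EuclideanSpace ℝ (Fin n)) ≪ volume := by
  rw [← map_pi_eq_stdGaussian, ← (PiLp.volume_preserving_toLp (Fin n)).map_eq]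
  exact (pi_gauss_ac n).map (by fun_prop)

section
variable {E : Type*} [NormedAddCommGroup E] [InnerProductSpace ℝ E] [FiniteDimensional ℝ E]
  [MeasurableSpace E] [BorelSpace E]

lemma rot_inv (θ : ℝ) : MeasurePreserving (fun p : E × E =>
    (Real.cos θ • p.1 + Real.sin θ • p.2, -Real.sin θ • p.1 + Real.cos θ • p.2))
    ((stdGaussian E).prod (stdGaussian E)) ((stdGaussian E).prod (stdGaussian E)) := by
  refine ⟨by fun_prop, ?_⟩
  exact IsGaussian.map_rotation_eq_self_of_forall_strongDual_eq_zero (fun L => by simp) θ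

lemma lint_dual_sq (L : StrongDual ℝ E) :
    ∫⁻ y, ENNReal.ofReal ((L y) ^ 2) ∂(stdGaussian E) = ENNReal.ofReal (‖L‖ ^ 2) := by
  have hm : MemLp L 2 (stdGaussian E) := IsGaussian.memLp_dual _ L 2 (by simp)
  rw [← ofReal_integral_eq_lintegral_ofReal hm.integrable_sq (ae_of_all _ fun x => sq_nonneg _),
    ← variance_dual_stdGaussian, variance_of_integral_eq_zero (by fun_prop) (by simp)]

lemma poinc_step (f : E → ℝ) (hf : LipschitzWith 1 f) (m : ℕ) (hm : 0 < m) :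
    ∫⁻ p, ENNReal.ofReal ((f p.1 - f p.2) ^ 2) ∂((stdGaussian E).prod (stdGaussian E)) ≤
    ∫⁻ p, ENNReal.ofReal ((m * (f (Real.cos (Real.pi / 2 / m) • p.1 + Real.sin (Real.pi / 2 / m) • p.2) - f p.1)) ^ 2)
      ∂((stdGaussian E).prod (stdGaussian E)) := by
  set δ := Real.pi / 2 / m with hδ
  have hmR : (m : ℝ) ≠ 0 := by positivity
  have hfc := hf.continuous
  have hfm : Measurable f := hfc.measurable
  let g : ℝ → E × E → ℝ := fun θ p => f (Real.cos θ • p.1 + Real.sin θ • p.2)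
  have hgm : ∀ θ, Measurable (g θ) := fun θ => hfm.comp (by fun_prop)
  have key : ∀ k : ℕ, ∫⁻ p, ENNReal.ofReal ((g ((k + 1 : ℕ) * δ) p - g (k * δ) p) ^ 2)
      ∂((stdGaussian E).prod (stdGaussian E)) =
      ∫⁻ p, ENNReal.ofReal ((g δ p - f p.1) ^ 2) ∂((stdGaussian E).prod (stdGaussian E)) := by
    intro k
    rw [← (rot_inv (E := E) (k * δ)).lintegral_comp (f := fun p => ENNReal.ofReal ((g δ p - f p.1) ^ 2))
      (((((hgm δ).sub (hfm.comp measurable_fst)).pow_const 2)).ennreal_ofReal)]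
    refine lintegral_congr fun p => ?_
    congr 3
    simp only [g]
    congr 1
    push_cast
    rw [add_mul, one_mul, Real.cos_add, Real.sin_add]
    module
  calc _ ≤ ∫⁻ p, ∑ k ∈ Finset.range m, ENNReal.ofReal (m * (g ((k + 1 : ℕ) * δ) p - g (k * δ) p) ^ 2)
      ∂((stdGaussian E).prod (stdGaussian E)) := by
        refine lintegral_mono fun p => ?_
        rw [← ENNReal.ofReal_sum_of_nonneg (fun i _ => by positivity)]
        refine ENNReal.ofReal_le_ofReal ?_
        have h1 := Finset.sum_range_sub (fun k : ℕ => g (k * δ) p) m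
        have h2 : (m : ℝ) * δ = Real.pi / 2 := by rw [hδ]; field_simp
        have h3 : f p.1 - f p.2 = - ∑ k ∈ Finset.range m, (g ((k + 1 : ℕ) * δ) p - g (k * δ) p) := by
          rw [h1, h2]; simp [g]
        rw [h3, neg_sq, ← Finset.mul_sum]
        have := sq_sum_le_card_mul_sum_sq (s := Finset.range m) (f := fun k : ℕ => (g ((k + 1 : ℕ) * δ) p - g (k * δ) p))
        simpa using this
    _ = ∑ k ∈ Finset.range m, ENNReal.ofReal m * ∫⁻ p, ENNReal.ofReal ((g δ p - f p.1) ^ 2)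
         ∂((stdGaussian E).prod (stdGaussian E)) := by
        rw [lintegral_finsetSum]
        · refine Finset.sum_congr rfl fun k _ => ?_
          rw [← key k, ← lintegral_const_mul]
          · refine lintegral_congr fun p => ?_
            rw [ENNReal.ofReal_mul (by positivity)]
          · exact (((hgm _).sub (hgm _)).pow_const 2).ennreal_ofReal
        · intro k _
          exact ((((hgm _).sub (hgm _)).pow_const 2).const_mul _).ennreal_ofReal
    _ = _ := by
        rw [Finset.sum_const, Finset.card_range, nsmul_eq_mul, ← mul_assoc,
          ← lintegral_const_mul]
        · refine lintegral_congr fun p => ?_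
          rw [← ENNReal.ofReal_natCast, ← ENNReal.ofReal_mul (by positivity), ← ENNReal.ofReal_mul (by positivity)]
          congr 1
          simp only [g]; ring
        · exact (((hgm δ).sub (hfm.comp measurable_fst)).pow_const 2).ennreal_ofReal
end

lemma poinc {N : ℕ} (f : EuclideanSpace ℝ (Fin N) → ℝ) (hf : LipschitzWith 1 f) :
    ∫⁻ p, ENNReal.ofReal ((f p.1 - f p.2) ^ 2)
      ∂((stdGaussian (EuclideanSpace ℝ (Fin N))).prod (stdGaussian (EuclideanSpace ℝ (Fin N)))) ≤
    ENNReal.ofReal ((Real.pi / 2) ^ 2) := by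
  set γ := stdGaussian (EuclideanSpace ℝ (Fin N)) with hγ
  have hfm : Measurable f := hf.continuous.measurable
  have hdiff : ∀ᵐ p ∂(γ.prod γ), DifferentiableAt ℝ f p.1 :=
    Measure.quasiMeasurePreserving_fst.ae ((stdGauss_ac N).ae_le hf.ae_differentiableAt)
  have hlim := tendsto_lintegral_of_dominated_convergence (μ := γ.prod γ)
    (F := fun (m : ℕ) p => ENNReal.ofReal (((m : ℝ) * (f (Real.cos (Real.pi / 2 / m) • p.1 + Real.sin (Real.pi / 2 / m) • p.2) - f p.1)) ^ 2))
    (f := fun p => ENNReal.ofReal ((Real.pi / 2 * fderiv ℝ f p.1 p.2) ^ 2))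
    (fun p => ENNReal.ofReal (8 * (‖p.1‖ ^ 2 + ‖p.2‖ ^ 2))) ?_ ?_ ?_ ?_
  · refine (ge_of_tendsto hlim ((eventually_gt_atTop 0).mono fun m hm => poinc_step f hf m hm)).trans ?_
    have hmd : Measurable (fderiv ℝ f) := measurable_fderiv ℝ f
    rw [lintegral_prod]
    · have : ∀ x, ∫⁻ y, ENNReal.ofReal ((Real.pi / 2 * fderiv ℝ f x y) ^ 2) ∂γ ≤ ENNReal.ofReal ((Real.pi / 2) ^ 2) := by
        intro x
        have := lint_dual_sq ((Real.pi / 2) • fderiv ℝ f x)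
        simp only [_root_.smul_apply, smul_eq_mul] at this
        rw [this]
        refine ENNReal.ofReal_le_ofReal ?_
        have h1 := norm_fderiv_le_of_lipschitz ℝ hf (x₀ := x)
        rw [norm_smul, mul_pow]
        simp only [NNReal.coe_one] at h1
        have : ‖fderiv ℝ f x‖ ^ 2 ≤ 1 := pow_le_one₀ (norm_nonneg _) h1
        simp only [Real.norm_eq_abs, sq_abs]
        exact mul_le_of_le_one_right (by positivity) this
      refine (lintegral_mono this).trans ?_
      simp
    · refine (Measurable.ennreal_ofReal ?_).aemeasurable
      refine (Measurable.const_mul ?_ _).pow_const 2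
      have : Measurable (fun p : (EuclideanSpace ℝ (Fin N) →L[ℝ] ℝ) × EuclideanSpace ℝ (Fin N) => p.1 p.2) := by
        exact isBoundedBilinearMap_apply.continuous.measurable
      exact this.comp ((hmd.comp measurable_fst).prodMk measurable_snd)
  · intro m
    refine Measurable.ennreal_ofReal ?_
    refine (Measurable.const_mul ?_ _).pow_const 2
    exact (hfm.comp (by fun_prop)).sub (hfm.comp measurable_fst)
  · intro m
    refine ae_of_all _ fun p => ENNReal.ofReal_le_ofReal ?_
    rcases Nat.eq_zero_or_pos m with rfl | hm
    · simp; positivity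
    have hmR : (0:ℝ) < m := by positivity
    have hm1 : (1:ℝ) ≤ m := by exact_mod_cast hm
    set δ := Real.pi / 2 / m with hδ
    have h2 : (m : ℝ) * δ = Real.pi / 2 := by rw [hδ]; field_simp
    have hδ0 : 0 ≤ δ := by rw [hδ]; positivity
    have hpi := Real.pi_le_four
    have hδ2 : δ ≤ 2 := by nlinarith
    have hl := hf.dist_le_mul (Real.cos δ • p.1 + Real.sin δ • p.2) p.1
    have hc1 := Real.one_sub_sq_div_two_le_cos (x := δ)
    have hc2 := Real.cos_le_one δ
    have hc : |Real.cos δ - 1| ≤ δ := by rw [abs_le]; constructor <;> nlinarith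
    have hs : |Real.sin δ| ≤ δ := by simpa [abs_of_nonneg hδ0] using Real.abs_sin_le_abs (x := δ)
    have hn : ‖Real.cos δ • p.1 + Real.sin δ • p.2 - p.1‖ ≤ δ * ‖p.1‖ + δ * ‖p.2‖ := by
      have : Real.cos δ • p.1 + Real.sin δ • p.2 - p.1 = (Real.cos δ - 1) • p.1 + Real.sin δ • p.2 := by module
      rw [this]
      refine (norm_add_le _ _).trans ?_
      rw [norm_smul, norm_smul, Real.norm_eq_abs, Real.norm_eq_abs]
      gcongr
    rw [Real.dist_eq, dist_eq_norm] at hl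
    simp only [NNReal.coe_one, one_mul] at hl
    have h3 : |(m:ℝ) * (f (Real.cos δ • p.1 + Real.sin δ • p.2) - f p.1)| ≤ 2 * (‖p.1‖ + ‖p.2‖) := by
      rw [abs_mul, abs_of_pos hmR]
      calc _ ≤ (m:ℝ) * (δ * ‖p.1‖ + δ * ‖p.2‖) := by gcongr; exact hl.trans hn
        _ = (m * δ) * (‖p.1‖ + ‖p.2‖) := by ring
        _ ≤ _ := by rw [h2]; gcongr; linarith
    rw [← sq_abs]
    calc _ ≤ (2 * (‖p.1‖ + ‖p.2‖)) ^ 2 := by gcongr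
      _ ≤ _ := by nlinarith [sq_nonneg (‖p.1‖ - ‖p.2‖)]
  · have hi : Integrable (fun x => ‖x‖ ^ 2) γ := (IsGaussian.memLp_two_id (μ := γ)).integrable_norm_pow (p := 2) (by simp)
    have : Integrable (fun p : EuclideanSpace ℝ (Fin N) × EuclideanSpace ℝ (Fin N) => 8 * (‖p.1‖ ^ 2 + ‖p.2‖ ^ 2)) (γ.prod γ) :=
      ((hi.comp_fst γ).add (hi.comp_snd γ)).const_mul 8
    exact this.lintegral_lt_top.ne
  · filter_upwards [hdiff] with p hp
    refine (ENNReal.continuous_ofReal.tendsto _).comp (Tendsto.pow ?_ 2)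
    have hd : HasDerivAt (fun θ : ℝ => f (Real.cos θ • p.1 + Real.sin θ • p.2)) (fderiv ℝ f p.1 p.2) 0 := by
      have h1 : HasDerivAt (fun θ : ℝ => Real.cos θ • p.1 + Real.sin θ • p.2) p.2 0 := by
        have := ((Real.hasDerivAt_cos 0).smul_const p.1).add ((Real.hasDerivAt_sin 0).smul_const p.2)
        simpa using! this
      have h2 : HasFDerivAt f (fderiv ℝ f p.1) (Real.cos 0 • p.1 + Real.sin 0 • p.2) := by
        simpa using hp.hasFDerivAt
      exact h2.comp_hasDerivAt 0 h1
    have h3 := hd.hasFDerivAt.lim_real (Real.pi / 2) |>.comp tendsto_natCast_atTop_atTop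
    simp only [Function.comp_def, smul_eq_mul, zero_add, Real.cos_zero, Real.sin_zero, one_smul, zero_smul, add_zero] at h3
    simpa [div_eq_inv_mul, mul_comm, mul_left_comm] using h3

section
variable {E : Type*} [NormedAddCommGroup E] [InnerProductSpace ℝ E] [FiniteDimensional ℝ E]
  [MeasurableSpace E] [BorelSpace E]

lemma charFun_const (μ : Measure E) (hinv : ∀ T : E ≃ₗᵢ[ℝ] E, Measure.map T μ = μ)
    {s t : E} (h : ‖t‖ = ‖s‖) : charFun μ t = charFun μ s := by
  let T : E ≃ₗᵢ[ℝ] E := (Submodule.span ℝ {t - s})ᗮ.reflection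
  have hT : T t = s := Submodule.reflection_sub h
  rw [charFun_apply, charFun_apply]
  conv_rhs => rw [← hinv T]
  rw [integral_map T.continuous.aemeasurable (by fun_prop)]
  refine integral_congr_ae (ae_of_all _ fun x => ?_)
  simp only
  rw [← hT, T.inner_map_map]

lemma polar (μ : Measure E) [IsProbabilityMeasure μ] (hinv : ∀ T : E ≃ₗᵢ[ℝ] E, Measure.map T μ = μ)
    (hs : ∀ᵐ u ∂μ, ‖u‖ = 1) :
    ((stdGaussian E).prod μ).map (fun p => ‖p.1‖ • p.2) = stdGaussian E := by
  set γ := stdGaussian E with hγ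
  have hγinv : ∀ T : E ≃ₗᵢ[ℝ] E, Measure.map T γ = γ := fun T => stdGaussian_map T
  have : IsProbabilityMeasure ((γ.prod μ).map (fun p => ‖p.1‖ • p.2)) :=
    Measure.isProbabilityMeasure_map (by fun_prop)
  apply Measure.ext_of_charFun
  ext t
  have hexpint : ∀ g : E × E → ℝ, Measurable g → Integrable (fun p => Complex.exp (g p * Complex.I)) (γ.prod μ) := by
    intro g hg
    refine Integrable.of_bound (C := 1) (by fun_prop) (ae_of_all _ fun p => ?_)
    rw [Complex.norm_exp_ofReal_mul_I]
  calc charFun ((γ.prod μ).map (fun p => ‖p.1‖ • p.2)) t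
      = ∫ x, charFun μ (‖x‖ • t) ∂γ := by
        rw [charFun_apply, integral_map (by fun_prop) (by fun_prop),
          integral_prod _ (hexpint (fun p => inner ℝ (‖p.1‖ • p.2) t) (by fun_prop))]
        simp only [charFun_apply, real_inner_smul_left, real_inner_smul_right]
    _ = ∫ x, charFun μ (‖t‖ • x) ∂γ := by
        refine integral_congr_ae (ae_of_all _ fun x => charFun_const μ hinv ?_)
        simp [norm_smul, mul_comm]
    _ = ∫ u, charFun γ (‖t‖ • u) ∂μ := by
        simp only [charFun_apply]
        rw [integral_integral_swap (hexpint (fun p => inner ℝ p.2 (‖t‖ • p.1)) (by fun_prop))]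
        simp only [real_inner_smul_right]
        simp_rw [real_inner_comm]
    _ = ∫ u, charFun γ t ∂μ := by
        refine integral_congr_ae ?_
        filter_upwards [hs] with u hu
        exact charFun_const γ hγinv (by simp [norm_smul, hu])
    _ = charFun γ t := by simp
end

lemma lint_norm_sq (N : ℕ) : ∫⁻ x, ENNReal.ofReal (‖x‖ ^ 2) ∂(stdGaussian (EuclideanSpace ℝ (Fin N))) = N := by
  have h : ∀ x : EuclideanSpace ℝ (Fin N), ENNReal.ofReal (‖x‖ ^ 2) =
      ∑ i, ENNReal.ofReal ((innerSL ℝ (EuclideanSpace.single i (1:ℝ)) x) ^ 2) := by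
    intro x
    rw [← ENNReal.ofReal_sum_of_nonneg (fun i _ => by positivity), EuclideanSpace.real_norm_sq_eq]
    simp [EuclideanSpace.inner_single_left]
  simp_rw [h]
  rw [lintegral_finsetSum _ (fun i _ => by fun_prop)]
  simp_rw [lint_dual_sq]
  simp

lemma main_est {N : ℕ} (μ : Measure (EuclideanSpace ℝ (Fin N))) [IsProbabilityMeasure μ]
    (hinv : ∀ T : EuclideanSpace ℝ (Fin N) ≃ₗᵢ[ℝ] EuclideanSpace ℝ (Fin N), Measure.map T μ = μ)
    (hs : ∀ᵐ u ∂μ, ‖u‖ = 1) (ε : ℝ) (hε : 0 < ε) (A B : Set (EuclideanSpace ℝ (Fin N)))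
    (hA : MeasurableSet A) (hB : MeasurableSet B) (hA1 : ∀ a ∈ A, ‖a‖ = 1) (hB1 : ∀ b ∈ B, ‖b‖ = 1)
    (hAne : A.Nonempty) (hAB : ∀ a ∈ A, ∀ b ∈ B, ε ≤ dist b a) :
    (N * ENNReal.ofReal (ε ^ 2 / 4)) * (μ A * μ B) ≤ ENNReal.ofReal ((Real.pi / 2) ^ 2) := by
  set γ := stdGaussian (EuclideanSpace ℝ (Fin N)) with hγ
  let C : Set (EuclideanSpace ℝ (Fin N)) := {x | ∃ t : ℝ, 0 ≤ t ∧ ∃ a ∈ A, x = t • a}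
  have hCne : C.Nonempty := by
    obtain ⟨a, ha⟩ := hAne
    exact ⟨a, 1, zero_le_one, a, ha, by simp⟩
  let f : EuclideanSpace ℝ (Fin N) → ℝ := fun x => infDist x C
  have hf : LipschitzWith 1 f := lipschitz_infDist_pt C
  have hfA : ∀ r : ℝ, 0 ≤ r → ∀ a ∈ A, f (r • a) = 0 := fun r hr a ha =>
    infDist_zero_of_mem ⟨r, hr, a, ha, rfl⟩
  have hfB : ∀ r : ℝ, 0 ≤ r → ∀ b ∈ B, r * (ε / 2) ≤ f (r • b) := by
    intro r hr b hb
    refine (le_infDist hCne).2 ?_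
    rintro _ ⟨t, ht, a, ha, rfl⟩
    have h1 := hAB a ha b hb
    have h2 : r * ε ≤ ‖r • b - r • a‖ := by
      rw [← smul_sub, norm_smul, Real.norm_of_nonneg hr, ← dist_eq_norm]
      gcongr
    have h3 : ‖r • b - r • a‖ ≤ ‖r • b - t • a‖ + ‖t • a - r • a‖ := norm_sub_le_norm_sub_add_norm_sub _ _ _
    have h4 : ‖t • a - r • a‖ = |t - r| := by rw [← sub_smul, norm_smul, hA1 a ha, mul_one, Real.norm_eq_abs]
    have h5 := abs_norm_sub_norm_le (t • a) (r • b)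
    rw [norm_smul, norm_smul, hA1 a ha, hB1 b hb, Real.norm_of_nonneg hr, Real.norm_of_nonneg ht, mul_one, mul_one,
      norm_sub_rev] at h5
    rw [dist_eq_norm]
    linarith
  have hp := poinc f hf
  rw [← hγ] at hp
  have hpol := polar μ hinv hs
  rw [← hγ] at hpol
  have hmeas : Measurable (fun p : EuclideanSpace ℝ (Fin N) × EuclideanSpace ℝ (Fin N) => ‖p.1‖ • p.2) := by fun_prop
  have hfm : Measurable f := hf.continuous.measurable
  have hpp : γ.prod γ = ((γ.prod μ).prod (γ.prod μ)).map
      (Prod.map (fun p => ‖p.1‖ • p.2) (fun p => ‖p.1‖ • p.2)) := by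
    rw [← Measure.map_prod_map _ _ hmeas hmeas, hpol]
  rw [hpp, lintegral_map
    (f := fun p : EuclideanSpace ℝ (Fin N) × EuclideanSpace ℝ (Fin N) => ENNReal.ofReal ((f p.1 - f p.2) ^ 2))
    ((((hfm.comp measurable_fst).sub (hfm.comp measurable_snd)).pow_const 2).ennreal_ofReal) (hmeas.prodMap hmeas)] at hp
  refine le_trans ?_ hp
  calc (N * ENNReal.ofReal (ε ^ 2 / 4)) * (μ A * μ B)
      = (∫⁻ p, A.indicator 1 p.2 ∂(γ.prod μ)) * (∫⁻ p, (ENNReal.ofReal (‖p.1‖ ^ 2)) * (ENNReal.ofReal (ε ^ 2 / 4) * B.indicator 1 p.2) ∂(γ.prod μ)) := by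
        have e1 : ∫⁻ p, A.indicator 1 p.2 ∂(γ.prod μ) = μ A := by
          have := lintegral_prod_mul (μ := γ) (ν := μ) (f := fun _ => 1) (g := A.indicator 1) (by fun_prop)
            ((measurable_one.indicator hA).aemeasurable)
          simpa [lintegral_indicator_one hA] using this
        rw [e1, lintegral_prod_mul (f := fun x => ENNReal.ofReal (‖x‖ ^ 2)) (g := fun u => ENNReal.ofReal (ε ^ 2 / 4) * B.indicator 1 u)
          (by fun_prop) (((measurable_one.indicator hB).const_mul _).aemeasurable),
          lintegral_const_mul _ (measurable_one.indicator hB), lintegral_indicator_one hB, hγ, lint_norm_sq]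
        ring
    _ = ∫⁻ q, A.indicator 1 q.1.2 * ((ENNReal.ofReal (‖q.2.1‖ ^ 2)) * (ENNReal.ofReal (ε ^ 2 / 4) * B.indicator 1 q.2.2)) ∂((γ.prod μ).prod (γ.prod μ)) := by
        refine (lintegral_prod_mul (f := fun p : EuclideanSpace ℝ (Fin N) × EuclideanSpace ℝ (Fin N) => A.indicator 1 p.2)
          (g := fun p : EuclideanSpace ℝ (Fin N) × EuclideanSpace ℝ (Fin N) => (ENNReal.ofReal (‖p.1‖ ^ 2)) * (ENNReal.ofReal (ε ^ 2 / 4) * B.indicator 1 p.2)) ?_ ?_).symm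
        · exact ((measurable_one.indicator hA).comp measurable_snd).aemeasurable
        · exact (Measurable.mul (by fun_prop) (((measurable_one.indicator hB).comp measurable_snd).const_mul _)).aemeasurable
    _ ≤ _ := by
        refine lintegral_mono fun q => ?_
        by_cases ha : q.1.2 ∈ A
        · by_cases hb : q.2.2 ∈ B
          · simp only [Set.indicator_of_mem ha, Set.indicator_of_mem hb, Pi.one_apply, one_mul, mul_one, Prod.map]
            rw [← ENNReal.ofReal_mul (by positivity)]
            refine ENNReal.ofReal_le_ofReal ?_
            rw [hfA _ (norm_nonneg _) _ ha, zero_sub, neg_sq]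
            have := hfB _ (norm_nonneg q.2.1) _ hb
            calc _ = (‖q.2.1‖ * (ε / 2)) ^ 2 := by ring
              _ ≤ _ := by gcongr
          · simp [hb]
        · simp [ha]

end Helpers

/-- The unit Euclidean spheres form a Lévy family: if `μ_n` is the
rotation-invariant Borel probability measure on the unit sphere `S^n ⊆ ℝ^{n+1}`
(formalized as a probability measure on `ℝ^{n+1}` carried by the sphere and
invariant under all linear isometries), then the concentration functions tend to
zero: `α_{S^n}(ε) → 0` as `n → ∞`, for every `ε > 0`. -/
theorem stmt16 (μ : ∀ n : ℕ, Measure (EuclideanSpace ℝ (Fin (n + 1))))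
    (hprob : ∀ n, IsProbabilityMeasure (μ n))
    (hsupp : ∀ n, μ n (Metric.sphere (0 : EuclideanSpace ℝ (Fin (n + 1))) 1) = 1)
    (hinv : ∀ n, ∀ T : EuclideanSpace ℝ (Fin (n + 1)) ≃ₗᵢ[ℝ]
        EuclideanSpace ℝ (Fin (n + 1)), Measure.map T (μ n) = μ n)
    (ε : ℝ) (hε : 0 < ε) :
    Tendsto (fun n : ℕ => concFn (μ n) ε) atTop (nhds 0) := by
  have key : ∀ n, ∀ A : Set (EuclideanSpace ℝ (Fin (n + 1))), MeasurableSet A →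
      1 / 2 ≤ (μ n A).toReal →
      1 - (2 * Real.pi ^ 2 / ε ^ 2) * (1 / ((n : ℝ) + 1)) ≤ (μ n (Metric.thickening ε A)).toReal := by
    intro n A hA hhalf
    have := hprob n
    set S := Metric.sphere (0 : EuclideanSpace ℝ (Fin (n + 1))) 1 with hS
    have hSm : MeasurableSet S := isClosed_sphere.measurableSet
    have hSae : ∀ᵐ u ∂(μ n), u ∈ S := (prob_compl_eq_zero_iff hSm).2 (hsupp n)
    have hs : ∀ᵐ u ∂(μ n), ‖u‖ = 1 := by
      filter_upwards [hSae] with u hu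
      simpa [hS] using hu
    have hAS : μ n (A ∩ S) = μ n A := measure_congr (by
      filter_upwards [hSae] with u hu
      exact propext ⟨fun h => h.1, fun h => ⟨h, hu⟩⟩)
    have hTm : MeasurableSet (Metric.thickening ε A) := isOpen_thickening.measurableSet
    have hBS : μ n ((Metric.thickening ε A)ᶜ ∩ S) = μ n (Metric.thickening ε A)ᶜ := measure_congr (by
      filter_upwards [hSae] with u hu
      exact propext ⟨fun h => h.1, fun h => ⟨h, hu⟩⟩)
    have hne : (A ∩ S).Nonempty := by
      rw [Set.nonempty_iff_ne_empty]
      intro h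
      rw [← hAS, h] at hhalf
      norm_num at hhalf
    have est := main_est (μ n) (hinv n) hs ε hε (A ∩ S) ((Metric.thickening ε A)ᶜ ∩ S)
      (hA.inter hSm) (hTm.compl.inter hSm) (fun a ha => by simpa [hS] using ha.2)
      (fun a ha => by simpa [hS] using ha.2) hne (by
        intro a ha b hb
        by_contra! hlt
        exact hb.1 (mem_thickening_iff.2 ⟨a, ha.1, hlt⟩))
    rw [hAS, hBS] at est
    have est2 := ENNReal.toReal_mono ENNReal.ofReal_ne_top est
    rw [ENNReal.toReal_mul, ENNReal.toReal_mul, ENNReal.toReal_mul, ENNReal.toReal_ofReal (by positivity),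
      ENNReal.toReal_ofReal (by positivity), ENNReal.toReal_natCast] at est2
    have hc : (μ n (Metric.thickening ε A)ᶜ).toReal = 1 - (μ n (Metric.thickening ε A)).toReal :=
      probReal_compl_eq_one_sub hTm
    rw [hc] at est2
    set r := (μ n (Metric.thickening ε A)).toReal with hr
    have hr1 : r ≤ 1 := by
      rw [hr]; exact measureReal_le_one
    push_cast at est2
    have h5 : ((n:ℝ) + 1) * (ε ^ 2 / 4) * (1 / 2 * (1 - r)) ≤ (Real.pi / 2) ^ 2 := by
      refine le_trans ?_ est2
      gcongr
    have h6 : 1 - r ≤ (2 * Real.pi ^ 2 / ε ^ 2) * (1 / ((n : ℝ) + 1)) := by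
      rw [div_mul_div_comm, le_div_iff₀ (by positivity)]
      nlinarith
    linarith
  have hlim : Tendsto (fun n : ℕ => (2 * Real.pi ^ 2 / ε ^ 2) * (1 / ((n : ℝ) + 1))) atTop (nhds 0) := by
    simpa using (tendsto_one_div_add_atTop_nhds_zero_nat (𝕜 := ℝ)).const_mul (2 * Real.pi ^ 2 / ε ^ 2)
  refine squeeze_zero ?_ ?_ hlim
  · intro n
    have := hprob n
    have hmem : ∃ A : Set (EuclideanSpace ℝ (Fin (n + 1))), MeasurableSet A ∧ 1 / 2 ≤ (μ n A).toReal ∧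
      (μ n (Metric.thickening ε Set.univ)).toReal = (μ n (Metric.thickening ε A)).toReal :=
      ⟨Set.univ, MeasurableSet.univ, by simp; norm_num, rfl⟩
    have h1 : sInf {r : ℝ | ∃ A : Set (EuclideanSpace ℝ (Fin (n + 1))), MeasurableSet A ∧ 1 / 2 ≤ (μ n A).toReal ∧
      r = (μ n (Metric.thickening ε A)).toReal} ≤ (μ n (Metric.thickening ε Set.univ)).toReal := by
      refine csInf_le ⟨0, ?_⟩ hmem
      rintro r ⟨A, -, -, rfl⟩
      exact ENNReal.toReal_nonneg
    have h2 : (μ n (Metric.thickening ε Set.univ)).toReal ≤ 1 := measureReal_le_one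
    unfold concFn
    linarith
  · intro n
    have := hprob n
    unfold concFn
    have : 1 - (2 * Real.pi ^ 2 / ε ^ 2) * (1 / ((n : ℝ) + 1)) ≤
        sInf {r : ℝ | ∃ A : Set (EuclideanSpace ℝ (Fin (n + 1))), MeasurableSet A ∧ 1 / 2 ≤ (μ n A).toReal ∧
      r = (μ n (Metric.thickening ε A)).toReal} := by
      refine le_csInf ⟨_, Set.univ, MeasurableSet.univ, by simp; norm_num, rfl⟩ ?_
      rintro r ⟨A, hA, hh, rfl⟩
      exact key n A hA hh
    linarith
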